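/- arXiv:0806.2610 — 2 statements merged into one kernel-verified Lean document; each statement's English description precedes it below -/
import Mathlib

section
/- Let Γ^α_{μν} be a smooth connection on a convex open set U ⊆ ℝⁿ. Then the Cartan tensor F^α_{μν} = Γ^α_{μν} − Γ^α_{νμ} and the Riemann tensor F^a{}_{jki} = ∂_k Γ^a_{ji} − ∂_i Γ^a_{jk} + Γ^a_{rk}Γ^r_{ji} − Γ^a_{ri}Γ^r_{jk} both vanish identically on U if and only if there exists a smooth map f : U → ℝⁿ whose Jacobian matrix is invertible at every point and which satisfies ∂_μ ∂_ν f^κ = Σ_α Γ^α_{μν} ∂_α f^κ on U (i.e., in the coordinates x' = f(x) the transformed connection is identically zero). -/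
/-- The partial derivative of `f : ℝⁿ → ℝ` in the `μ`-th coordinate direction. -/
noncomputable def pd {n : ℕ} (μ : Fin n) (f : (Fin n → ℝ) → ℝ) (x : Fin n → ℝ) : ℝ :=
  fderiv ℝ f x (Pi.single μ 1)

section Aux

set_option maxSynthPendingDepth 3
open Set Metric Filter Topology

lemma aux_linear_ode {n : ℕ} (A : ℝ → (Fin n → ℝ) →L[ℝ] (Fin n → ℝ))
    (hA : ContinuousOn A (Icc 0 1)) (p0 : Fin n → ℝ) :
    ∃ q : ℝ → (Fin n → ℝ), q 0 = p0 ∧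
      ∀ t ∈ Icc (0:ℝ) 1, HasDerivWithinAt q (A t (q t)) (Icc 0 1) t := by
  obtain ⟨C, hC⟩ := isCompact_Icc.exists_bound_of_continuousOn hA
  have hC0 : 0 ≤ C := (norm_nonneg _).trans (hC 0 (by simp))
  set R : ℝ := ‖p0‖ * Real.exp C with hR
  have hR0 : 0 ≤ R := by positivity
  let cl : (Fin n → ℝ) → (Fin n → ℝ) := fun p i => max (-R) (min R (p i))
  have cl_le : ∀ p, ‖cl p‖ ≤ ‖p‖ := by
    intro p
    refine (pi_norm_le_iff_of_nonneg (norm_nonneg _)).2 fun i => ?_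
    refine le_trans ?_ (norm_le_pi_norm p i)
    simp only [cl, Real.norm_eq_abs]
    grind
  have cl_leR : ∀ p, ‖cl p‖ ≤ R := by
    intro p
    refine (pi_norm_le_iff_of_nonneg hR0).2 fun i => ?_
    simp only [cl, Real.norm_eq_abs]
    grind
  have cl_eq : ∀ p, ‖p‖ ≤ R → cl p = p := by
    intro p hp
    funext i
    have := (norm_le_pi_norm p i).trans hp
    simp only [cl, Real.norm_eq_abs] at *
    grind
  have cl_lip : ∀ p q, ‖cl p - cl q‖ ≤ ‖p - q‖ := by
    intro p q
    refine (pi_norm_le_iff_of_nonneg (norm_nonneg _)).2 fun i => ?_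
    refine le_trans ?_ (norm_le_pi_norm (p - q) i)
    simp only [cl, Real.norm_eq_abs, Pi.sub_apply]
    grind
  have hPL : IsPicardLindelof (fun t p => A t (cl p)) (tmin := 0) (tmax := 1) ⟨0, by simp⟩ p0
      (Real.toNNReal (C * R)) 0 (Real.toNNReal (C * R)) (Real.toNNReal C) := by
    constructor
    · intro t ht
      refine LipschitzOnWith.of_dist_le_mul fun p _ q _ => ?_
      rw [dist_eq_norm, dist_eq_norm, ← map_sub, Real.coe_toNNReal _ hC0]
      exact (A t).le_of_opNorm_le_of_le (hC t ht) (cl_lip p q)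
    · intro p _
      exact hA.clm_apply continuousOn_const
    · intro t ht p _
      rw [Real.coe_toNNReal _ (by positivity)]
      exact (A t).le_of_opNorm_le_of_le (hC t ht) (cl_leR p)
    · simp
  obtain ⟨q, hq0, hq⟩ := hPL.exists_eq_forall_mem_Icc_hasDerivWithinAt₀
  refine ⟨q, hq0, fun t ht => ?_⟩
  have hb : ∀ t ∈ Icc (0:ℝ) 1, ‖q t‖ ≤ gronwallBound ‖p0‖ C 0 (t - 0) := by
    refine norm_le_gronwallBound_of_norm_deriv_right_le
      (fun t ht => (hq t ht).continuousWithinAt) (f' := fun t => A t (cl (q t))) ?_ ?_ ?_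
    · intro t ht
      exact (hq t ⟨ht.1, ht.2.le⟩).mono_of_mem_nhdsWithin (Icc_mem_nhdsGE_of_mem ht)
    · exact le_of_eq (congrArg norm hq0)
    · intro t ht
      rw [add_zero]
      exact (A t).le_of_opNorm_le_of_le (hC t ⟨ht.1, ht.2.le⟩) (cl_le _)
  have h2 : ‖q t‖ ≤ R := by
    refine (hb t ht).trans ?_
    rw [gronwallBound_ε0, hR]
    gcongr
    nlinarith [ht.1, ht.2]
  have := hq t ht
  simp only [cl_eq _ h2] at this
  exact this

lemma aux_unif_diff {E G : Type*} [NormedAddCommGroup E] [NormedSpace ℝ E] [ProperSpace E]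
    [NormedAddCommGroup G] [NormedSpace ℝ G]
    {U K : Set E} (hU : IsOpen U) (hK : IsCompact K) (hKU : K ⊆ U)
    {w : E → G} {dw : E → E →L[ℝ] G} (hw : ∀ x ∈ U, HasFDerivAt w (dw x) x)
    (hdw : ContinuousOn dw U) {ε : ℝ} (hε : 0 < ε) :
    ∃ δ > 0, ∀ c ∈ K, ∀ k : E, ‖k‖ ≤ δ →
      c + k ∈ U ∧ ‖w (c + k) - w c - dw c k‖ ≤ ε * ‖k‖ := by
  obtain ⟨δ₁, hδ₁, hsub⟩ := hK.exists_cthickening_subset_open hU hKU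
  have hK' : IsCompact (cthickening δ₁ K) := hK.cthickening
  have huc := hK'.uniformContinuousOn_of_continuous (hdw.mono hsub)
  obtain ⟨δ₂, hδ₂, h2⟩ := Metric.uniformContinuousOn_iff.1 huc ε hε
  refine ⟨min δ₁ (δ₂ / 2), by positivity, fun c hc k hk => ?_⟩
  have hball : ∀ y ∈ closedBall c (min δ₁ (δ₂ / 2)), y ∈ cthickening δ₁ K := by
    intro y hy
    refine mem_cthickening_of_dist_le y c δ₁ K hc ?_
    exact (mem_closedBall.1 hy).trans (min_le_left _ _)
  have hck : c + k ∈ closedBall c (min δ₁ (δ₂ / 2)) := by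
    simpa [mem_closedBall, dist_eq_norm] using hk
  have hcc : c ∈ closedBall c (min δ₁ (δ₂ / 2)) := mem_closedBall_self (by positivity)
  refine ⟨hsub (hball _ hck), ?_⟩
  have := (convex_closedBall c (min δ₁ (δ₂ / 2))).norm_image_sub_le_of_norm_hasFDerivWithin_le'
    (f := w) (f' := dw) (φ := dw c) (C := ε)
    (fun y hy => (hw y (hsub (hball y hy))).hasFDerivWithinAt) ?_ hcc hck
  · simpa using this
  · intro y hy
    rw [← dist_eq_norm]
    refine (h2 y (hball y hy) c (hball c hcc) ?_).le
    have := (mem_closedBall.1 hy).trans (min_le_right _ _)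
    linarith

lemma aux_gronwall_lin (K e : ℝ) (hK : 0 < K) :
    gronwallBound 0 K e 1 = e * ((Real.exp K - 1) / K) := by
  rw [gronwallBound_of_K_ne_0 hK.ne']
  simp
  ring

lemma aux_frobenius {E F : Type*} [NormedAddCommGroup E] [NormedSpace ℝ E]
    [NormedAddCommGroup F] [NormedSpace ℝ F] [ProperSpace E]
    (hode : ∀ A : ℝ → F →L[ℝ] F, ContinuousOn A (Icc 0 1) → ∀ p0 : F,
      ∃ q : ℝ → F, q 0 = p0 ∧
        ∀ t ∈ Icc (0:ℝ) 1, HasDerivWithinAt q (A t (q t)) (Icc 0 1) t)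
    {U : Set E} (hU : IsOpen U) (hUc : Convex ℝ U)
    {w : E → E →L[ℝ] F →L[ℝ] F}
    {dw : E → E →L[ℝ] E →L[ℝ] F →L[ℝ] F}
    (hw : ∀ x ∈ U, HasFDerivAt w (dw x) x)
    (hdw : ContinuousOn dw U)
    (hflat : ∀ x ∈ U, ∀ a b p, dw x a b p + w x b (w x a p) = dw x b a p + w x a (w x b p))
    {x0 : E} (hx0 : x0 ∈ U) (p0 : F) :
    ∃ p : E → F, p x0 = p0 ∧ ∀ x ∈ U, HasFDerivAt p ((w x).flip (p x)) x := by
  have hwc : ContinuousOn w U := fun x hx => (hw x hx).continuousAt.continuousWithinAt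
  have hmem : ∀ x ∈ U, ∀ t ∈ Icc (0:ℝ) 1, x0 + t • (x - x0) ∈ U := fun x hx t ht =>
    hUc.add_smul_sub_mem hx0 hx ht
  have hex : ∀ x, ∃ q : ℝ → F, x ∈ U → q 0 = p0 ∧
      ∀ t ∈ Icc (0:ℝ) 1,
        HasDerivWithinAt q (w (x0 + t • (x - x0)) (x - x0) (q t)) (Icc 0 1) t := by
    intro x
    by_cases hx : x ∈ U
    · obtain ⟨q, h⟩ := hode (fun t => w (x0 + t • (x - x0)) (x - x0))
        (ContinuousOn.clm_apply (hwc.comp (by fun_prop) (hmem x hx)) continuousOn_const) p0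
      exact ⟨q, fun _ => h⟩
    · exact ⟨0, fun h => absurd h hx⟩
  choose Q hQ using hex
  refine ⟨fun x => Q x 1, ?_, ?_⟩
  · -- at the base point the equation is trivial
    obtain ⟨h0, h1⟩ := hQ x0 hx0
    have := constant_of_has_deriv_right_zero (f := Q x0) (a := 0) (b := 1)
      (fun t ht => (h1 t ht).continuousWithinAt) (fun t ht => by
        have := (h1 t ⟨ht.1, ht.2.le⟩).mono_of_mem_nhdsWithin (Icc_mem_nhdsGE_of_mem ht)
        simpa using this)
    exact (this 1 (by simp)).trans h0
  intro x hx
  set u := x - x0 with hu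
  set c : ℝ → E := fun t => x0 + t • u with hc
  have hcU : ∀ t ∈ Icc (0:ℝ) 1, c t ∈ U := hmem x hx
  have hcc : Continuous c := by fun_prop
  obtain ⟨hq0, hq⟩ := hQ x hx
  set q := Q x with hqdef
  have hqc : ContinuousOn q (Icc 0 1) := fun t ht => (hq t ht).continuousWithinAt
  obtain ⟨M1, hM1⟩ : ∃ M, ∀ t ∈ Icc (0:ℝ) 1, ‖w (c t)‖ ≤ M :=
    isCompact_Icc.exists_bound_of_continuousOn (f := fun t => w (c t))
    (hwc.comp hcc.continuousOn hcU)
  obtain ⟨M2, hM2⟩ : ∃ M, ∀ t ∈ Icc (0:ℝ) 1, ‖dw (c t)‖ ≤ M :=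
    isCompact_Icc.exists_bound_of_continuousOn (f := fun t => dw (c t))
    (hdw.comp hcc.continuousOn hcU)
  obtain ⟨M3, hM3⟩ := isCompact_Icc.exists_bound_of_continuousOn hqc
  have hM10 : 0 ≤ M1 := (norm_nonneg _).trans (hM1 0 (by simp))
  have hM20 : 0 ≤ M2 := (norm_nonneg _).trans (hM2 0 (by simp))
  have hM30 : 0 ≤ M3 := (norm_nonneg _).trans (hM3 0 (by simp))
  set S := ‖u‖ + 1 with hS
  have hS0 : 0 < S := by positivity
  set K := (M1 + M2 + 1) * S with hK
  have hK0 : 0 < K := by positivity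
  set C := M2 * M3 + S * M3 + (M2 + 1) * S * (M1 * M3) + M1 * (M1 * M3) with hC
  have hC0 : 0 ≤ C := by positivity
  set G := (Real.exp K - 1) / K with hG
  have hG0 : 0 ≤ G := by
    have : 1 ≤ Real.exp K := Real.one_le_exp hK0.le
    exact div_nonneg (by linarith) hK0.le
  -- main estimate
  have key : ∀ ε : ℝ, 0 < ε → ε ≤ 1 → ∃ δ > 0, ∀ h : E, ‖h‖ ≤ δ →
      ‖Q (x + h) 1 - (q 1 + w x h (q 1))‖ ≤ (C * ε * ‖h‖) * G := by
    intro ε hε hε1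
    obtain ⟨δ, hδ, hd⟩ := aux_unif_diff hU (isCompact_Icc.image hcc : IsCompact (c '' Icc (0:ℝ) 1))
      (by rintro _ ⟨t, ht, rfl⟩; exact hcU t ht) hw hdw hε
    refine ⟨min δ ε, by positivity, fun h hh => ?_⟩
    have hhδ : ‖h‖ ≤ δ := hh.trans (min_le_left _ _)
    have hhε : ‖h‖ ≤ ε := hh.trans (min_le_right _ _)
    have hh1 : ‖h‖ ≤ 1 := hhε.trans hε1
    have hth : ∀ t ∈ Icc (0:ℝ) 1, ‖t • h‖ ≤ ‖h‖ := by
      intro t ht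
      rw [norm_smul, Real.norm_of_nonneg ht.1]
      exact mul_le_of_le_one_left (norm_nonneg _) ht.2
    have hdt : ∀ t ∈ Icc (0:ℝ) 1,
        ‖w (c t + t • h) - w (c t) - dw (c t) (t • h)‖ ≤ ε * ‖h‖ := by
      intro t ht
      refine (hd (c t) ⟨t, ht, rfl⟩ (t • h) ((hth t ht).trans hhδ)).2.trans ?_
      exact mul_le_mul_of_nonneg_left (hth t ht) hε.le
    have hyU : x + h ∈ U := by
      have := (hd (c 1) ⟨1, by simp, rfl⟩ h hhδ).1
      simpa [hc, hu] using this
    obtain ⟨hr0, hr⟩ := hQ (x + h) hyU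
    set r := Q (x + h) with hrdef
    have hcy : ∀ t : ℝ, x0 + t • (u + h) = c t + t • h := by
      intro t
      simp only [hc]
      module
    have hyu : x + h - x0 = u + h := by simp only [hu]; abel
    simp only [hyu, hcy] at hr
    set Z : ℝ → F := fun t => q t + t • w (c t) h (q t) with hZ
    set Z' : ℝ → F := fun t => w (c t) u (q t) + (w (c t) h (q t)
      + t • (dw (c t) u h (q t) + w (c t) h (w (c t) u (q t)))) with hZ'
    have hZd : ∀ t ∈ Icc (0:ℝ) 1, HasDerivWithinAt Z (Z' t) (Icc 0 1) t := by
      intro t ht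
      have h1 : HasDerivWithinAt c u (Icc 0 1) t := by
        have : HasDerivAt c u t := by
          simpa only [one_smul] using! ((hasDerivAt_id t).smul_const u).const_add x0
        exact this.hasDerivWithinAt
      have h2 : HasDerivWithinAt (fun t => w (c t)) (dw (c t) u) (Icc 0 1) t :=
        (hw (c t) (hcU t ht)).comp_hasDerivWithinAt t h1
      have h3 : HasDerivWithinAt (fun t => w (c t) h) (dw (c t) u h) (Icc 0 1) t := by
        simpa using h2.clm_apply (hasDerivWithinAt_const t _ h)
      have h4 := h3.clm_apply (hq t ht)
      have h5 := (hq t ht).add ((hasDerivWithinAt_id t _).smul h4)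
      refine h5.congr_deriv ?_
      simp only [hZ', id]
      module
    -- the error term
    have herr : ∀ t ∈ Icc (0:ℝ) 1,
        ‖Z' t - w (c t + t • h) (u + h) (Z t)‖ ≤ C * ε * ‖h‖ := by
      intro t ht
      set η := w (c t + t • h) - w (c t) - dw (c t) (t • h) with hη
      have hηb : ‖η‖ ≤ ε * ‖h‖ := hdt t ht
      have e1 : w (c t + t • h) = w (c t) + dw (c t) (t • h) + η := by rw [hη]; abel
      have e2 : Z' t - w (c t + t • h) (u + h) (Z t) =
          -(dw (c t) (t • h) h (q t) + η (u + h) (q t)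
            + (dw (c t) (t • h) + η) (u + h) (w (c t) (t • h) (q t))
            + w (c t) h (w (c t) (t • h) (q t))) := by
        have hf := hflat (c t) (hcU t ht) u h (q t)
        have hf' : dw (c t) u h (q t) = dw (c t) h u (q t) + w (c t) u (w (c t) h (q t))
            - w (c t) h (w (c t) u (q t)) := by rw [← hf]; abel
        rw [e1]
        simp only [hZ, hZ', hf', map_add, map_smul, add_apply, smul_apply]
        module
      have hhn := norm_nonneg h
      have huh : ‖u + h‖ ≤ S := (norm_add_le _ _).trans (by rw [hS]; linarith)
      have b1 : ‖dw (c t) (t • h)‖ ≤ M2 * ‖h‖ :=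
        (dw (c t)).le_of_opNorm_le_of_le (hM2 t ht) (hth t ht)
      have b2 : ‖w (c t) (t • h) (q t)‖ ≤ M1 * ‖h‖ * M3 :=
        ContinuousLinearMap.le_of_opNorm_le_of_le _
          ((w (c t)).le_of_opNorm_le_of_le (hM1 t ht) (hth t ht)) (hM3 t ht)
      have t1 : ‖dw (c t) (t • h) h (q t)‖ ≤ M2 * ‖h‖ * ‖h‖ * M3 :=
        ContinuousLinearMap.le_of_opNorm_le_of_le _
          (ContinuousLinearMap.le_of_opNorm_le_of_le _ b1 le_rfl) (hM3 t ht)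
      have t2 : ‖η (u + h) (q t)‖ ≤ ε * ‖h‖ * S * M3 :=
        ContinuousLinearMap.le_of_opNorm_le_of_le _
          (ContinuousLinearMap.le_of_opNorm_le_of_le _ hηb huh) (hM3 t ht)
      have t3 : ‖(dw (c t) (t • h) + η) (u + h) (w (c t) (t • h) (q t))‖
          ≤ (M2 * ‖h‖ + ε * ‖h‖) * S * (M1 * ‖h‖ * M3) :=
        ContinuousLinearMap.le_of_opNorm_le_of_le _
          (ContinuousLinearMap.le_of_opNorm_le_of_le _ (norm_add_le_of_le b1 hηb) huh) b2
      have t4 : ‖w (c t) h (w (c t) (t • h) (q t))‖ ≤ M1 * ‖h‖ * (M1 * ‖h‖ * M3) :=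
        ContinuousLinearMap.le_of_opNorm_le_of_le _
          (ContinuousLinearMap.le_of_opNorm_le_of_le _ (hM1 t ht) le_rfl) b2
      rw [e2, norm_neg]
      refine (norm_add_le_of_le (norm_add_le_of_le (norm_add_le_of_le t1 t2) t3) t4).trans ?_
      have s1 : M2 * ‖h‖ * ‖h‖ * M3 ≤ M2 * ‖h‖ * ε * M3 := by gcongr
      have s3 : (M2 * ‖h‖ + ε * ‖h‖) * S * (M1 * ‖h‖ * M3)
          ≤ (M2 * ‖h‖ + 1 * ‖h‖) * S * (M1 * ε * M3) := by gcongr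
      have s4 : M1 * ‖h‖ * (M1 * ‖h‖ * M3) ≤ M1 * ‖h‖ * (M1 * ε * M3) := by gcongr
      calc _ ≤ M2 * ‖h‖ * ε * M3 + ε * ‖h‖ * S * M3
            + (M2 * ‖h‖ + 1 * ‖h‖) * S * (M1 * ε * M3) + M1 * ‖h‖ * (M1 * ε * M3) := by gcongr
        _ = C * ε * ‖h‖ := by rw [hC]; ring
    have hgr := norm_le_gronwallBound_of_norm_deriv_right_le (f := fun t => r t - Z t)
      (f' := fun t => w (c t + t • h) (u + h) (r t) - Z' t) (a := 0) (b := 1)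
      (δ := 0) (K := K) (ε := C * ε * ‖h‖)
      (fun t ht => ((hr t ht).sub (hZd t ht)).continuousWithinAt)
      (fun t ht => ((hr t ⟨ht.1, ht.2.le⟩).sub (hZd t ⟨ht.1, ht.2.le⟩)).mono_of_mem_nhdsWithin
        (Icc_mem_nhdsGE_of_mem ht))
      (by simp [hZ, hr0, hq0])
      (by
        intro t ht'
        have ht : t ∈ Icc (0:ℝ) 1 := ⟨ht'.1, ht'.2.le⟩
        have e : w (c t + t • h) (u + h) (r t) - Z' t =
            w (c t + t • h) (u + h) (r t - Z t) - (Z' t - w (c t + t • h) (u + h) (Z t)) := by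
          rw [map_sub]; abel
        have hwb : ‖w (c t + t • h)‖ ≤ M1 + M2 + 1 := by
          have e1 : w (c t + t • h) = w (c t) + dw (c t) (t • h)
            + (w (c t + t • h) - w (c t) - dw (c t) (t • h)) := by abel
          have b1 : ‖dw (c t) (t • h)‖ ≤ M2 * 1 :=
            (dw (c t)).le_of_opNorm_le_of_le (hM2 t ht) ((hth t ht).trans hh1)
          have b2 : ε * ‖h‖ ≤ 1 := mul_le_one₀ hε1 (norm_nonneg _) hh1
          rw [e1]
          refine (norm_add_le_of_le (norm_add_le_of_le (hM1 t ht) b1) ((hdt t ht).trans b2)).trans ?_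
          linarith
        have huh : ‖u + h‖ ≤ S := (norm_add_le _ _).trans (by rw [hS]; linarith)
        show ‖w (c t + t • h) (u + h) (r t) - Z' t‖ ≤ _
        rw [e]
        refine norm_sub_le_of_le ?_ (herr t ht)
        exact ContinuousLinearMap.le_of_opNorm_le_of_le _
          (ContinuousLinearMap.le_of_opNorm_le_of_le _ hwb huh) le_rfl)
      1 (by simp)
    rw [sub_zero, aux_gronwall_lin _ _ hK0] at hgr
    have hc1 : c 1 = x := by simp [hc, hu]
    simpa [hZ, hc1] using hgr
  rw [hasFDerivAt_iff_isLittleO_nhds_zero, Asymptotics.isLittleO_iff]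
  intro e he
  set ε := min 1 (e / (C * G + 1)) with hε
  have hCG : 0 < C * G + 1 := by positivity
  have hε0 : 0 < ε := by positivity
  obtain ⟨δ, hδ, hk⟩ := key ε hε0 (min_le_left _ _)
  filter_upwards [closedBall_mem_nhds (0 : E) hδ] with h hh
  have := hk h (by simpa using hh)
  rw [← sub_sub] at this
  refine this.trans ?_
  have h1 : ε * (C * G + 1) ≤ e := by
    rw [← le_div_iff₀ hCG]; exact min_le_right _ _
  calc C * ε * ‖h‖ * G = (ε * (C * G)) * ‖h‖ := by ring
    _ ≤ e * ‖h‖ := by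
      gcongr
      nlinarith

lemma aux_zero {E F : Type*} [NormedAddCommGroup E] [NormedSpace ℝ E]
    [NormedAddCommGroup F] [NormedSpace ℝ F]
    {U : Set E} (hUc : Convex ℝ U)
    {w : E → E →L[ℝ] F →L[ℝ] F} (hw : ContinuousOn w U)
    {p : E → F} (hp : ∀ x ∈ U, HasFDerivAt p ((w x).flip (p x)) x)
    {x y : E} (hx : x ∈ U) (hy : y ∈ U) (h0 : p x = 0) : p y = 0 := by
  set c : ℝ → E := fun t => x + t • (y - x) with hc
  have hcU : ∀ t ∈ Icc (0:ℝ) 1, c t ∈ U := fun t ht => hUc.add_smul_sub_mem hx hy ht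
  have hcc : Continuous c := by fun_prop
  obtain ⟨M1, hM1⟩ : ∃ M, ∀ t ∈ Icc (0:ℝ) 1, ‖w (c t)‖ ≤ M :=
    isCompact_Icc.exists_bound_of_continuousOn (f := fun t => w (c t))
    (hw.comp hcc.continuousOn hcU)
  have hd : ∀ t ∈ Icc (0:ℝ) 1, HasDerivAt (fun t => p (c t)) (w (c t) (y - x) (p (c t))) t := by
    intro t ht
    have h1 : HasDerivAt c (y - x) t := by
      simpa only [one_smul] using! ((hasDerivAt_id t).smul_const (y - x)).const_add x
    exact (hp (c t) (hcU t ht)).comp_hasDerivAt t h1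
  have := eq_zero_of_abs_deriv_le_mul_abs_self_of_eq_zero_right (f := fun t => p (c t))
    (a := 0) (b := 1) (K := M1 * ‖y - x‖)
    (fun t ht => (hd t ht).continuousAt.continuousWithinAt)
    (fun t ht => (hd t ⟨ht.1, ht.2.le⟩).hasDerivWithinAt) (by simp [hc, h0])
    (fun t ht => ContinuousLinearMap.le_of_opNorm_le_of_le _
      (ContinuousLinearMap.le_of_opNorm_le_of_le _ (hM1 t ⟨ht.1, ht.2.le⟩) le_rfl) le_rfl)
    1 (by simp)
  simpa [hc] using this

lemma aux_smooth {E F : Type*} [NormedAddCommGroup E] [NormedSpace ℝ E]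
    [NormedAddCommGroup F] [NormedSpace ℝ F]
    {U : Set E} (hU : IsOpen U)
    {w : E → E →L[ℝ] F →L[ℝ] F} (hw : ContDiffOn ℝ (⊤ : ℕ∞) w U)
    {p : E → F} (hp : ∀ x ∈ U, HasFDerivAt p ((w x).flip (p x)) x) :
    ContDiffOn ℝ (⊤ : ℕ∞) p U := by
  rw [contDiffOn_infty]
  intro m
  induction m with
  | zero =>
    exact contDiffOn_zero.2 fun x hx => (hp x hx).continuousAt.continuousWithinAt
  | succ m ih =>
    push_cast
    rw [contDiffOn_succ_iff_fderiv_of_isOpen hU]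
    refine ⟨fun x hx => (hp x hx).differentiableAt.differentiableWithinAt, by simp, ?_⟩
    have h1 : ContDiffOn ℝ m (fun x => (w x).flip (p x)) U := by
      have hw' : ContDiffOn ℝ m w U := hw.of_le (by exact_mod_cast le_top)
      have : ContDiffOn ℝ m (fun x => (w x).flip) U :=
        ((ContinuousLinearMap.flipₗᵢ ℝ E F F).toContinuousLinearEquiv.toContinuousLinearMap :
          (E →L[ℝ] F →L[ℝ] F) →L[ℝ] (F →L[ℝ] E →L[ℝ] F)).contDiff.comp_contDiffOn hw'
      exact this.clm_apply ih
    exact h1.congr fun x hx => (hp x hx).fderiv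

noncomputable def auxT {n : ℕ} (μ ν α : Fin n) :
    (Fin n → ℝ) →L[ℝ] (Fin n → ℝ) →L[ℝ] (Fin n → ℝ) :=
  (ContinuousLinearMap.proj (R := ℝ) (φ := fun _ : Fin n => ℝ) μ).smulRight
    ((ContinuousLinearMap.proj (R := ℝ) (φ := fun _ : Fin n => ℝ) α).smulRight
      (Pi.single ν (1:ℝ) : Fin n → ℝ))

noncomputable def auxW (n : ℕ) : (Fin n → Fin n → Fin n → ℝ) →L[ℝ]
    ((Fin n → ℝ) →L[ℝ] (Fin n → ℝ) →L[ℝ] (Fin n → ℝ)) :=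
  LinearMap.toContinuousLinearMap
    { toFun := fun g => ∑ μ, ∑ ν, ∑ α, g α μ ν • auxT μ ν α
      map_add' := by
        intro g h
        simp only [Pi.add_apply, add_smul, Finset.sum_add_distrib]
      map_smul' := by
        intro c g
        simp only [Pi.smul_apply, smul_assoc, Finset.smul_sum, RingHom.id_apply] }

lemma auxW_apply {n : ℕ} (g : Fin n → Fin n → Fin n → ℝ) (a p : Fin n → ℝ) (ν : Fin n) :
    auxW n g a p ν = ∑ μ, ∑ α, g α μ ν * (a μ * p α) := by
  have : auxW n g = ∑ μ, ∑ ν, ∑ α, g α μ ν • auxT μ ν α := rfl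
  rw [this]
  simp only [_root_.sum_apply, smul_apply, auxT, ContinuousLinearMap.smulRight_apply,
    ContinuousLinearMap.proj_apply, Finset.sum_apply, Pi.smul_apply, Pi.single_apply, smul_eq_mul]
  refine Finset.sum_congr rfl fun μ _ => ?_
  rw [Finset.sum_comm]
  simp

lemma aux_fderiv_eq_sum {n : ℕ} (f : (Fin n → ℝ) → ℝ) (x a : Fin n → ℝ) :
    fderiv ℝ f x a = ∑ k, a k * pd k f x := by
  conv_lhs => rw [pi_eq_sum_univ' a]
  simp [map_sum, pd, Pi.single_apply, eq_comm]

lemma aux_forward (n : ℕ) (U : Set (Fin n → ℝ)) (hU : IsOpen U) (hUconv : Convex ℝ U)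
    (Γ : (Fin n → ℝ) → Fin n → Fin n → Fin n → ℝ)
    (hΓ : ∀ α μ ν : Fin n, ContDiffOn ℝ (⊤ : ℕ∞) (fun x => Γ x α μ ν) U)
    (hC : ∀ x ∈ U, ∀ α μ ν : Fin n, Γ x α μ ν - Γ x α ν μ = 0)
    (hR : ∀ x ∈ U, ∀ a j k i : Fin n,
        pd k (fun y => Γ y a j i) x - pd i (fun y => Γ y a j k) x
          + ∑ r, (Γ x a r k * Γ x r j i - Γ x a r i * Γ x r j k) = 0) :
    (∃ f : (Fin n → ℝ) → (Fin n → ℝ),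
      (∀ κ : Fin n, ContDiffOn ℝ (⊤ : ℕ∞) (fun x => f x κ) U) ∧
      (∀ x ∈ U, (Matrix.of fun κ α : Fin n => pd α (fun y => f y κ) x).det ≠ 0) ∧
      (∀ x ∈ U, ∀ κ μ ν : Fin n,
        pd μ (pd ν (fun y => f y κ)) x
          = ∑ α, Γ x α μ ν * pd α (fun y => f y κ) x)) := by
  rcases U.eq_empty_or_nonempty with rfl | ⟨x0, hx0⟩
  · exact ⟨0, by simp [contDiffOn_const], by simp, by simp⟩
  have hsym : ∀ x ∈ U, ∀ α μ ν : Fin n, Γ x α μ ν = Γ x α ν μ := fun x hx α μ ν =>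
    sub_eq_zero.1 (hC x hx α μ ν)
  have hpdsym : ∀ x ∈ U, ∀ k α μ ν : Fin n,
      pd k (fun y => Γ y α μ ν) x = pd k (fun y => Γ y α ν μ) x := by
    intro x hx k α μ ν
    have : (fun y => Γ y α μ ν) =ᶠ[𝓝 x] (fun y => Γ y α ν μ) := by
      filter_upwards [hU.mem_nhds hx] with y hy using hsym y hy α μ ν
    simp only [pd, this.fderiv_eq]
  have hΓs : ContDiffOn ℝ (⊤ : ℕ∞) Γ U := by
    rw [contDiffOn_pi]; intro α
    rw [contDiffOn_pi]; intro μ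
    rw [contDiffOn_pi]; intro ν
    exact hΓ α μ ν
  have hΓd : ∀ x ∈ U, HasFDerivAt Γ (fderiv ℝ Γ x) x := fun x hx =>
    ((hΓs.contDiffAt (hU.mem_nhds hx)).differentiableAt (by simp)).hasFDerivAt
  have hcomp : ∀ x ∈ U, ∀ a α μ ν, fderiv ℝ Γ x a α μ ν = ∑ k, a k * pd k (fun y => Γ y α μ ν) x := by
    intro x hx a α μ ν
    rw [← aux_fderiv_eq_sum]
    have h1 := hasFDerivAt_pi'.1 (hasFDerivAt_pi'.1 (hasFDerivAt_pi'.1 (hΓd x hx) α) μ) ν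
    rw [h1.fderiv]
    rfl
  set w : (Fin n → ℝ) → (Fin n → ℝ) →L[ℝ] (Fin n → ℝ) →L[ℝ] (Fin n → ℝ) :=
    fun x => auxW n (Γ x) with hw
  have hws : ContDiffOn ℝ (⊤ : ℕ∞) w U := (auxW n).contDiff.comp_contDiffOn hΓs
  have hwd : ∀ x ∈ U, HasFDerivAt w ((auxW n).comp (fderiv ℝ Γ x)) x := fun x hx =>
    (auxW n).hasFDerivAt.comp x (hΓd x hx)
  have hdc : ContinuousOn (fun x => (auxW n).comp (fderiv ℝ Γ x)) U :=
    continuousOn_const.clm_comp (hΓs.continuousOn_fderiv_of_isOpen hU (by simp))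
  have hflat : ∀ x ∈ U, ∀ a b p, auxW n (fderiv ℝ Γ x a) b p + w x b (w x a p)
      = auxW n (fderiv ℝ Γ x b) a p + w x a (w x b p) := by
    intro x hx
    have hexp : ∀ a b p ν, (auxW n (fderiv ℝ Γ x a) b p + w x b (w x a p)) ν
        = ∑ k, ∑ i, ∑ α, a k * b i * p α *
          (pd k (fun y => Γ y α i ν) x + ∑ r, Γ x r i ν * Γ x α k r) := by
      intro a b p ν
      rw [Pi.add_apply]
      simp only [hw, auxW_apply, hcomp x hx, mul_add, Finset.sum_add_distrib, Finset.mul_sum,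
        Finset.sum_mul]
      congr 1
      · have : ∀ i α k, a k * pd k (fun y => Γ y α i ν) x * (b i * p α)
            = a k * b i * p α * pd k (fun y => Γ y α i ν) x := by intros; ring
        simp only [this]
        calc _ = ∑ i, ∑ k, ∑ α, a k * b i * p α * pd k (fun y => Γ y α i ν) x :=
              Finset.sum_congr rfl fun i _ => Finset.sum_comm
          _ = _ := Finset.sum_comm
      · have : ∀ i r k α, Γ x r i ν * (b i * (Γ x α k r * (a k * p α)))
            = a k * b i * p α * (Γ x r i ν * Γ x α k r) := by intros; ring
        simp only [this]
        calc _ = ∑ i, ∑ k, ∑ r, ∑ α, a k * b i * p α * (Γ x r i ν * Γ x α k r) :=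
              Finset.sum_congr rfl fun i _ => Finset.sum_comm
          _ = ∑ k, ∑ i, ∑ r, ∑ α, a k * b i * p α * (Γ x r i ν * Γ x α k r) := Finset.sum_comm
          _ = _ := Finset.sum_congr rfl fun k _ => Finset.sum_congr rfl fun i _ => Finset.sum_comm
    have hS : ∀ k i α ν, pd k (fun y => Γ y α i ν) x + ∑ r, Γ x r i ν * Γ x α k r
        = pd i (fun y => Γ y α k ν) x + ∑ r, Γ x r k ν * Γ x α i r := by
      intro k i α ν
      have h1 := hR x hx α ν k i
      rw [Finset.sum_sub_distrib] at h1
      have e1 : ∑ r, Γ x r i ν * Γ x α k r = ∑ r, Γ x α r k * Γ x r ν i :=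
        Finset.sum_congr rfl fun r _ => by rw [hsym x hx r i ν, hsym x hx α k r, mul_comm]
      have e2 : ∑ r, Γ x r k ν * Γ x α i r = ∑ r, Γ x α r i * Γ x r ν k :=
        Finset.sum_congr rfl fun r _ => by rw [hsym x hx r k ν, hsym x hx α i r, mul_comm]
      rw [e1, e2, hpdsym x hx k α i ν, hpdsym x hx i α k ν]
      linarith
    intro a b p
    funext ν
    rw [hexp, hexp, Finset.sum_comm]
    refine Finset.sum_congr rfl fun i _ => Finset.sum_congr rfl fun k _ =>
      Finset.sum_congr rfl fun α _ => ?_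
    rw [hS k i α ν]
    ring
  have hP : ∀ κ : Fin n, ∃ p : (Fin n → ℝ) → (Fin n → ℝ), p x0 = Pi.single κ 1 ∧
      ∀ x ∈ U, HasFDerivAt p ((w x).flip (p x)) x := fun κ =>
    aux_frobenius (fun A hA p0 => aux_linear_ode A hA p0) hU hUconv hwd hdc hflat hx0 _
  choose P hP0 hPd using hP
  have hPs : ∀ κ, ContDiffOn ℝ (⊤ : ℕ∞) (P κ) U := fun κ => aux_smooth hU hws (hPd κ)
  -- the linear map from covectors to linear forms
  let Lf : (Fin n → ℝ) →L[ℝ] ((Fin n → ℝ) →L[ℝ] ℝ) :=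
    LinearMap.toContinuousLinearMap
      { toFun := fun p => ∑ ν, p ν • ContinuousLinearMap.proj (R := ℝ) (φ := fun _ : Fin n => ℝ) ν
        map_add' := by
          intro g h
          simp only [Pi.add_apply, add_smul, Finset.sum_add_distrib]
        map_smul' := by
          intro c g
          simp only [Pi.smul_apply, smul_assoc, Finset.smul_sum, RingHom.id_apply] }
  have hLf : ∀ p a, Lf p a = ∑ ν, p ν * a ν := by
    intro p a
    have : Lf p = ∑ ν, p ν • ContinuousLinearMap.proj (R := ℝ) (φ := fun _ : Fin n => ℝ) ν := rfl
    rw [this]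
    simp [_root_.sum_apply]
  have hF : ∀ κ : Fin n, ∃ f : (Fin n → ℝ) → ℝ, ∀ x ∈ U, HasFDerivAt f (Lf (P κ x)) x := by
    intro κ
    have hd : ∀ x ∈ U, HasFDerivAt (fun x => Lf (P κ x)) (Lf.comp ((w x).flip (P κ x))) x :=
      fun x hx => Lf.hasFDerivAt.comp x (hPd κ x hx)
    refine hUconv.exists_forall_hasFDerivAt_of_fderiv_symmetric hU
      (fun x hx => (hd x hx).differentiableAt.differentiableWithinAt) ?_
    intro x hx a b
    rw [(hd x hx).fderiv]
    simp only [ContinuousLinearMap.comp_apply, ContinuousLinearMap.flip_apply, hLf, hw, auxW_apply,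
      Finset.sum_mul]
    rw [Finset.sum_comm]
    refine Finset.sum_congr rfl fun i _ => Finset.sum_congr rfl fun k _ =>
      Finset.sum_congr rfl fun α _ => ?_
    rw [hsym x hx α i k]
    ring
  choose f hf using hF
  have hpd : ∀ κ ν, ∀ x ∈ U, pd ν (f κ) x = P κ x ν := by
    intro κ ν x hx
    rw [pd, (hf κ x hx).fderiv, hLf]
    simp [Pi.single_apply]
  refine ⟨fun x κ => f κ x, ?_, ?_, ?_⟩
  · intro κ
    rw [contDiffOn_infty_iff_fderiv_of_isOpen hU]
    refine ⟨fun x hx => (hf κ x hx).differentiableAt.differentiableWithinAt, ?_⟩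
    exact (Lf.contDiff.comp_contDiffOn (hPs κ)).congr fun x hx => (hf κ x hx).fderiv
  · intro x hx hdet
    obtain ⟨v, hv0, hv⟩ := Matrix.exists_vecMul_eq_zero_iff.2 hdet
    apply hv0
    set p : (Fin n → ℝ) → (Fin n → ℝ) := fun y => ∑ κ, v κ • P κ y with hp
    have hpD : ∀ y ∈ U, HasFDerivAt p ((w y).flip (p y)) y := by
      intro y hy
      have h1 : HasFDerivAt p (∑ κ, v κ • (w y).flip (P κ y)) y :=
        HasFDerivAt.fun_sum fun κ _ => (hPd κ y hy).const_smul (v κ)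
      have h2 : (w y).flip (p y) = ∑ κ, v κ • (w y).flip (P κ y) := by
        simp only [hp, map_sum, map_smul]
      rw [h2]; exact h1
    have hpx : p x = 0 := by
      funext α
      have := congrFun hv α
      simp only [Matrix.vecMul, dotProduct, Matrix.of_apply, Pi.zero_apply] at this
      simp only [hp, Finset.sum_apply, Pi.smul_apply, smul_eq_mul, Pi.zero_apply]
      rw [← this]
      exact Finset.sum_congr rfl fun κ _ => by rw [hpd κ α x hx]
    have h0 := aux_zero hUconv hws.continuousOn hpD hx hx0 hpx
    funext κ
    have := congrFun h0 κ
    simpa [hp, hP0, Finset.sum_apply, Pi.single_apply] using this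
  · intro x hx κ μ ν
    have he : pd ν (fun y => f κ y) =ᶠ[𝓝 x] fun y => P κ y ν := by
      filter_upwards [hU.mem_nhds hx] with y hy using hpd κ ν y hy
    have h1 := hasFDerivAt_pi'.1 (hPd κ x hx) ν
    rw [pd, he.fderiv_eq, h1.fderiv]
    simp only [ContinuousLinearMap.comp_apply, ContinuousLinearMap.flip_apply,
      ContinuousLinearMap.proj_apply, hw, auxW_apply]
    rw [Finset.sum_eq_single μ]
    · exact Finset.sum_congr rfl fun α _ => by rw [hpd κ α x hx]; simp
    · intro b _ hb
      simp [Pi.single_apply, hb]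
    · simp

lemma aux_pd_symm {n : ℕ} {U : Set (Fin n → ℝ)} (hU : IsOpen U) {g : (Fin n → ℝ) → ℝ}
    (hg : ContDiffOn ℝ (⊤ : ℕ∞) g U) {x : Fin n → ℝ} (hx : x ∈ U) (μ ν : Fin n) :
    pd μ (pd ν g) x = pd ν (pd μ g) x := by
  have hat := hg.contDiffAt (hU.mem_nhds hx)
  have h2 : DifferentiableAt ℝ (fderiv ℝ g) x :=
    (hat.fderiv_right (m := (⊤ : ℕ∞)) (by simp)).differentiableAt (by simp)
  have hs : IsSymmSndFDerivAt ℝ g x := hat.isSymmSndFDerivAt (by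
    simp only [minSmoothness_of_isRCLikeNormedField]
    exact WithTop.coe_le_coe.2 (le_top : (2 : ℕ∞) ≤ ⊤))
  have h3 : ∀ μ ν : Fin n, pd μ (pd ν g) x
      = fderiv ℝ (fderiv ℝ g) x (Pi.single μ 1) (Pi.single ν 1) := by
    intro μ ν
    have : HasFDerivAt (pd ν g) _ x := h2.hasFDerivAt.clm_apply (hasFDerivAt_const _ x)
    rw [pd, this.fderiv]
    simp
  rw [h3, h3, hs.eq]

lemma aux_pd_smooth {n : ℕ} {U : Set (Fin n → ℝ)} (hU : IsOpen U) {g : (Fin n → ℝ) → ℝ}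
    (hg : ContDiffOn ℝ (⊤ : ℕ∞) g U) (ν : Fin n) : ContDiffOn ℝ (⊤ : ℕ∞) (pd ν g) U :=
  ContDiffOn.clm_apply (hg.fderiv_of_isOpen hU (by simp)) contDiffOn_const

lemma aux_backward (n : ℕ) (U : Set (Fin n → ℝ)) (hU : IsOpen U)
    (Γ : (Fin n → ℝ) → Fin n → Fin n → Fin n → ℝ)
    (hΓ : ∀ α μ ν : Fin n, ContDiffOn ℝ (⊤ : ℕ∞) (fun x => Γ x α μ ν) U)
    (f : (Fin n → ℝ) → (Fin n → ℝ))
    (hf : ∀ κ : Fin n, ContDiffOn ℝ (⊤ : ℕ∞) (fun x => f x κ) U)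
    (hJ : ∀ x ∈ U, (Matrix.of fun κ α : Fin n => pd α (fun y => f y κ) x).det ≠ 0)
    (hE : ∀ x ∈ U, ∀ κ μ ν : Fin n,
        pd μ (pd ν (fun y => f y κ)) x
          = ∑ α, Γ x α μ ν * pd α (fun y => f y κ) x) :
    (∀ x ∈ U, ∀ α μ ν : Fin n, Γ x α μ ν - Γ x α ν μ = 0) ∧
     (∀ x ∈ U, ∀ a j k i : Fin n,
        pd k (fun y => Γ y a j i) x - pd i (fun y => Γ y a j k) x
          + ∑ r, (Γ x a r k * Γ x r j i - Γ x a r i * Γ x r j k) = 0) := by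
  have hinj : ∀ x ∈ U, ∀ v : Fin n → ℝ,
      (∀ κ, ∑ α, v α * pd α (fun y => f y κ) x = 0) → ∀ α, v α = 0 := by
    intro x hx v hv α
    refine congrFun (Matrix.eq_zero_of_mulVec_eq_zero (hJ x hx) ?_) α
    funext κ
    simp only [Matrix.mulVec, dotProduct, Matrix.of_apply, Pi.zero_apply]
    rw [← hv κ]
    exact Finset.sum_congr rfl fun α _ => mul_comm _ _
  have hC : ∀ x ∈ U, ∀ α μ ν : Fin n, Γ x α μ ν - Γ x α ν μ = 0 := by
    intro x hx α μ ν
    refine hinj x hx (fun α => Γ x α μ ν - Γ x α ν μ) (fun κ => ?_) α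
    simp only [sub_mul, Finset.sum_sub_distrib]
    rw [← hE x hx, ← hE x hx, aux_pd_symm hU (hf κ) hx μ ν, sub_self]
  have hsym : ∀ x ∈ U, ∀ α μ ν : Fin n, Γ x α μ ν = Γ x α ν μ := fun x hx α μ ν =>
    sub_eq_zero.1 (hC x hx α μ ν)
  refine ⟨hC, ?_⟩
  intro x hx a j k i
  have h3 : ∀ κ k i, pd k (pd i (pd j (fun y => f y κ))) x =
      ∑ α, (pd k (fun y => Γ y α j i) x + ∑ r, Γ x α r k * Γ x r j i)
        * pd α (fun y => f y κ) x := by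
    intro κ k i
    have he : pd i (pd j (fun y => f y κ)) =ᶠ[𝓝 x]
        fun y => ∑ α, Γ y α j i * pd α (fun y => f y κ) y := by
      filter_upwards [hU.mem_nhds hx] with y hy
      rw [hE y hy]
      exact Finset.sum_congr rfl fun α _ => by rw [hsym y hy α i j]
    have hd1 : ∀ α, HasFDerivAt (fun y => Γ y α j i) (fderiv ℝ (fun y => Γ y α j i) x) x :=
      fun α => (((hΓ α j i).contDiffAt (hU.mem_nhds hx)).differentiableAt (by simp)).hasFDerivAt
    have hd2 : ∀ α, HasFDerivAt (pd α (fun y => f y κ)) (fderiv ℝ (pd α (fun y => f y κ)) x) x :=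
      fun α => (((aux_pd_smooth hU (hf κ) α).contDiffAt (hU.mem_nhds hx)).differentiableAt
        (by simp)).hasFDerivAt
    have hd3 : HasFDerivAt (fun y => ∑ α, Γ y α j i * pd α (fun y => f y κ) y) _ x :=
      HasFDerivAt.fun_sum fun α _ => (hd1 α).mul (hd2 α)
    have h4 : pd k (pd i (pd j (fun y => f y κ))) x =
        ∑ r, (Γ x r j i * pd k (pd r (fun y => f y κ)) x
          + pd r (fun y => f y κ) x * pd k (fun y => Γ y r j i) x) := by
      rw [pd, he.fderiv_eq, hd3.fderiv]
      simp [_root_.sum_apply, pd]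
    rw [h4]
    simp only [hE x hx, Finset.sum_add_distrib, add_mul, Finset.mul_sum, Finset.sum_mul]
    rw [add_comm]
    congr 1
    · exact Finset.sum_congr rfl fun α _ => mul_comm _ _
    · rw [Finset.sum_comm]
      refine Finset.sum_congr rfl fun α _ => Finset.sum_congr rfl fun r _ => ?_
      rw [hsym x hx α k r]; ring
  have := hinj x hx (fun a => pd k (fun y => Γ y a j i) x - pd i (fun y => Γ y a j k) x
          + ∑ r, (Γ x a r k * Γ x r j i - Γ x a r i * Γ x r j k)) (fun κ => ?_) a
  · exact this
  have h5 := aux_pd_symm hU (aux_pd_smooth hU (hf κ) j) hx k i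
  rw [h3, h3, ← sub_eq_zero, ← Finset.sum_sub_distrib] at h5
  rw [← h5]
  refine Finset.sum_congr rfl fun α _ => ?_
  rw [Finset.sum_sub_distrib]
  ring

end Aux

/-- for a smooth connection `Γ^α_{μν}` on a convex open set `U ⊆ ℝⁿ`, the
Cartan tensor `Γ^α_{μν} − Γ^α_{νμ}` and the Riemann tensor
`∂_k Γ^a_{ji} − ∂_i Γ^a_{jk} + Γ^a_{rk}Γ^r_{ji} − Γ^a_{ri}Γ^r_{jk}` both vanish
identically on `U` if and only if there is a smooth change of coordinates `f` with
everywhere invertible Jacobian in which the connection vanishes, i.e.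
`∂_μ ∂_ν f^κ = Σ_α Γ^α_{μν} ∂_α f^κ` on `U`. -/
theorem connection_vanishes_iff_cartan_riemann_zero
    (n : ℕ) (U : Set (Fin n → ℝ)) (hU : IsOpen U) (hUconv : Convex ℝ U)
    (Γ : (Fin n → ℝ) → Fin n → Fin n → Fin n → ℝ)
    (hΓ : ∀ α μ ν : Fin n, ContDiffOn ℝ (⊤ : ℕ∞) (fun x => Γ x α μ ν) U) :
    ((∀ x ∈ U, ∀ α μ ν : Fin n, Γ x α μ ν - Γ x α ν μ = 0) ∧
     (∀ x ∈ U, ∀ a j k i : Fin n,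
        pd k (fun y => Γ y a j i) x - pd i (fun y => Γ y a j k) x
          + ∑ r, (Γ x a r k * Γ x r j i - Γ x a r i * Γ x r j k) = 0)) ↔
    (∃ f : (Fin n → ℝ) → (Fin n → ℝ),
      (∀ κ : Fin n, ContDiffOn ℝ (⊤ : ℕ∞) (fun x => f x κ) U) ∧
      (∀ x ∈ U, (Matrix.of fun κ α : Fin n => pd α (fun y => f y κ) x).det ≠ 0) ∧
      (∀ x ∈ U, ∀ κ μ ν : Fin n,
        pd μ (pd ν (fun y => f y κ)) x
          = ∑ α, Γ x α μ ν * pd α (fun y => f y κ) x)) := by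
  constructor
  · rintro ⟨hC, hR⟩
    exact aux_forward n U hU hUconv Γ hΓ hC hR
  · rintro ⟨f, hf, hJ, hE⟩
    exact aux_backward n U hU Γ hΓ f hf hJ hE
end

section
/- (Fully contracted Jacobi–Bianchi identity.) Let g be a smooth metric on an open set U ⊆ ℝⁿ, with Levi-Civita connection Λ, Riemann curvature R^a{}_{jki}, Ricci tensor R_{ji} = R^a{}_{jai}, scalar curvature R = g^{ji}R_{ji}, and Einstein curvature tensor E^{μκ} = R^{μκ} − (1/2) g^{μκ} R (indices raised with g^{··}). Then the covariant divergence of E vanishes identically on U: ∇_μ E^{μκ} := ∂_μ E^{μκ} + E^{ρκ} Λ^μ_{ρμ} + E^{μρ} Λ^κ_{ρμ} = 0 for every κ. -/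
open Matrix

/-- The Levi-Civita connection `Λ^η_{αβ}` of a metric `g`. -/
noncomputable def levi {n : ℕ} (g : (Fin n → ℝ) → Matrix (Fin n) (Fin n) ℝ)
    (x : Fin n → ℝ) (η α β : Fin n) : ℝ :=
  (1 / 2) * ∑ μ, (g x)⁻¹ η μ *
    (pd β (fun y => g y α μ) x + pd α (fun y => g y μ β) x - pd μ (fun y => g y α β) x)

/-- The Riemann curvature tensor `R^a{}_{jki}` of the Levi-Civita connection of `g`. -/
noncomputable def riem {n : ℕ} (g : (Fin n → ℝ) → Matrix (Fin n) (Fin n) ℝ)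
    (x : Fin n → ℝ) (a j k i : Fin n) : ℝ :=
  pd k (fun y => levi g y a j i) x - pd i (fun y => levi g y a j k) x
    + ∑ r, (levi g x a r k * levi g x r j i - levi g x a r i * levi g x r j k)

/-- The Ricci tensor `R_{ji} = R^a{}_{jai}` of `g`. -/
noncomputable def ricci {n : ℕ} (g : (Fin n → ℝ) → Matrix (Fin n) (Fin n) ℝ)
    (x : Fin n → ℝ) (j i : Fin n) : ℝ :=
  ∑ a, riem g x a j a i

/-- The scalar curvature `R = g^{ji} R_{ji}` of `g`. -/
noncomputable def scal {n : ℕ} (g : (Fin n → ℝ) → Matrix (Fin n) (Fin n) ℝ)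
    (x : Fin n → ℝ) : ℝ :=
  ∑ j, ∑ i, (g x)⁻¹ j i * ricci g x j i

/-- The Einstein curvature tensor with both indices raised:
`E^{μκ} = g^{μa} g^{κb} (R_{ab} − (1/2) g_{ab} R)`. -/
noncomputable def einsteinUp {n : ℕ} (g : (Fin n → ℝ) → Matrix (Fin n) (Fin n) ℝ)
    (x : Fin n → ℝ) (μ κ : Fin n) : ℝ :=
  ∑ a, ∑ b, (g x)⁻¹ μ a * (g x)⁻¹ κ b * (ricci g x a b - (1 / 2) * g x a b * scal g x)


open scoped ContDiff

/-! ### Scalar calculus -/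

section scalar
variable {n : ℕ} {U : Set (Fin n → ℝ)} {f h : (Fin n → ℝ) → ℝ} {x : Fin n → ℝ}

lemma sm_diff (hU : IsOpen U) (hf : ContDiffOn ℝ ∞ f U) (hx : x ∈ U) :
    DifferentiableAt ℝ f x :=
  (hf.contDiffAt (hU.mem_nhds hx)).differentiableAt (by simp)

lemma pd_congr (hU : IsOpen U) (hx : x ∈ U) (hfh : ∀ y ∈ U, f y = h y) (μ : Fin n) :
    pd μ f x = pd μ h x := by
  have : f =ᶠ[nhds x] h := Filter.eventually_of_mem (hU.mem_nhds hx) hfh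
  simp only [pd, this.fderiv_eq]

lemma pd_add (hU : IsOpen U) (hf : ContDiffOn ℝ ∞ f U) (hh : ContDiffOn ℝ ∞ h U) (hx : x ∈ U)
    (μ : Fin n) : pd μ (fun y => f y + h y) x = pd μ f x + pd μ h x := by
  simp only [pd]
  rw [fderiv_fun_add (sm_diff hU hf hx) (sm_diff hU hh hx)]; rfl

lemma pd_sub (hU : IsOpen U) (hf : ContDiffOn ℝ ∞ f U) (hh : ContDiffOn ℝ ∞ h U) (hx : x ∈ U)
    (μ : Fin n) : pd μ (fun y => f y - h y) x = pd μ f x - pd μ h x := by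
  simp only [pd]
  rw [fderiv_fun_sub (sm_diff hU hf hx) (sm_diff hU hh hx)]; rfl

lemma pd_neg (μ : Fin n) : pd μ (fun y => - f y) x = - pd μ f x := by
  simp only [pd]
  rw [fderiv_fun_neg]; rfl

lemma pd_mul (hU : IsOpen U) (hf : ContDiffOn ℝ ∞ f U) (hh : ContDiffOn ℝ ∞ h U) (hx : x ∈ U)
    (μ : Fin n) : pd μ (fun y => f y * h y) x = pd μ f x * h x + f x * pd μ h x := by
  simp only [pd]
  rw [fderiv_fun_mul (sm_diff hU hf hx) (sm_diff hU hh hx)]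
  simp; ring

lemma pd_sum {ι : Type*} (s : Finset ι) {F : ι → (Fin n → ℝ) → ℝ} (hU : IsOpen U)
    (hF : ∀ i, ContDiffOn ℝ ∞ (F i) U) (hx : x ∈ U) (μ : Fin n) :
    pd μ (fun y => ∑ i ∈ s, F i y) x = ∑ i ∈ s, pd μ (F i) x := by
  simp only [pd]
  rw [fderiv_fun_sum (fun i _ => sm_diff hU (hF i) hx)]
  simp

lemma pd_smooth (hU : IsOpen U) (hf : ContDiffOn ℝ ∞ f U) (μ : Fin n) :
    ContDiffOn ℝ ∞ (pd μ f) U := by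
  have h1 : ContDiffOn ℝ ∞ (fderiv ℝ f) U := hf.fderiv_of_isOpen hU (by simp)
  exact h1.clm_apply contDiffOn_const

lemma pd_comm (hU : IsOpen U) (hf : ContDiffOn ℝ ∞ f U) (hx : x ∈ U) (μ ν : Fin n) :
    pd μ (pd ν f) x = pd ν (pd μ f) x := by
  have h1 : ContDiffOn ℝ ∞ (fderiv ℝ f) U := hf.fderiv_of_isOpen hU (by simp)
  have h2 : DifferentiableAt ℝ (fderiv ℝ f) x :=
    (h1.contDiffAt (hU.mem_nhds hx)).differentiableAt (by simp)
  have h3 : IsSymmSndFDerivAt ℝ f x :=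
    (hf.contDiffAt (hU.mem_nhds hx)).isSymmSndFDerivAt (by simp; exact WithTop.coe_le_coe.2 le_top)
  have key : ∀ v w : Fin n → ℝ,
      fderiv ℝ (fun y => fderiv ℝ f y v) x w = fderiv ℝ (fderiv ℝ f) x w v := by
    intro v w
    rw [fderiv_clm_apply h2 (differentiableAt_const v)]
    simp
  have := h3 (Pi.single μ 1) (Pi.single ν 1)
  unfold pd
  rw [key, key, this]

end scalar

/-! ### Matrix calculus -/

/-- Entrywise smoothness of a matrix-valued function. -/
def SmM {n : ℕ} (U : Set (Fin n → ℝ)) (M : (Fin n → ℝ) → Matrix (Fin n) (Fin n) ℝ) : Prop :=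
  ∀ i j, ContDiffOn ℝ ∞ (fun y => M y i j) U

/-- Entrywise partial derivative. -/
noncomputable def pdM {n : ℕ} (μ : Fin n) (M : (Fin n → ℝ) → Matrix (Fin n) (Fin n) ℝ)
    (x : Fin n → ℝ) : Matrix (Fin n) (Fin n) ℝ :=
  Matrix.of fun i j => pd μ (fun y => M y i j) x

section mat
variable {n : ℕ} {U : Set (Fin n → ℝ)} {M N : (Fin n → ℝ) → Matrix (Fin n) (Fin n) ℝ}
  {x : Fin n → ℝ}

lemma SmM.add (hM : SmM U M) (hN : SmM U N) : SmM U (fun y => M y + N y) :=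
  fun i j => (hM i j).add (hN i j)

lemma SmM.sub (hM : SmM U M) (hN : SmM U N) : SmM U (fun y => M y - N y) :=
  fun i j => (hM i j).sub (hN i j)

lemma SmM.neg (hM : SmM U M) : SmM U (fun y => - M y) :=
  fun i j => (hM i j).neg

lemma SmM.mul (hM : SmM U M) (hN : SmM U N) : SmM U (fun y => M y * N y) := by
  intro i j
  simp only [Matrix.mul_apply]
  exact ContDiffOn.sum fun k _ => (hM i k).mul (hN k j)

lemma SmM.transpose (hM : SmM U M) : SmM U (fun y => (M y)ᵀ) := fun i j => hM j i

lemma SmM.pd (hU : IsOpen U) (hM : SmM U M) (μ : Fin n) : SmM U (pdM μ M) :=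
  fun i j => pd_smooth hU (hM i j) μ

lemma SmM.det (hM : SmM U M) : ContDiffOn ℝ ∞ (fun y => (M y).det) U := by
  simp only [Matrix.det_apply]
  refine ContDiffOn.sum fun σ _ => ?_
  have : ContDiffOn ℝ ∞ (fun y => ∏ i, M y (σ i) i) U :=
    contDiffOn_prod fun i _ => hM _ _
  exact this.const_smul _

lemma SmM.inv (hM : SmM U M) (hd : ∀ y ∈ U, IsUnit (M y).det) : SmM U (fun y => (M y)⁻¹) := by
  intro i j
  have h1 : ContDiffOn ℝ ∞ (fun y => (M y).det⁻¹) U :=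
    hM.det.inv fun y hy => (hd y hy).ne_zero
  have h2 : ContDiffOn ℝ ∞ (fun y => (M y).adjugate i j) U := by
    simp only [Matrix.adjugate_apply]
    refine SmM.det (M := fun y => (M y).updateRow j (Pi.single i 1)) fun a b => ?_
    simp only [Matrix.updateRow_apply]
    split_ifs
    · exact contDiffOn_const
    · exact hM a b
  refine (h1.mul h2).congr fun y hy => ?_
  simp [Matrix.inv_def]

lemma pdM_congr (hU : IsOpen U) (hx : x ∈ U) (h : ∀ y ∈ U, M y = N y) (μ : Fin n) :
    pdM μ M x = pdM μ N x := by
  ext i j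
  exact pd_congr hU hx (fun y hy => by rw [h y hy]) μ

lemma pdM_add (hU : IsOpen U) (hM : SmM U M) (hN : SmM U N) (hx : x ∈ U) (μ : Fin n) :
    pdM μ (fun y => M y + N y) x = pdM μ M x + pdM μ N x := by
  ext i j
  exact pd_add hU (hM i j) (hN i j) hx μ

lemma pdM_sub (hU : IsOpen U) (hM : SmM U M) (hN : SmM U N) (hx : x ∈ U) (μ : Fin n) :
    pdM μ (fun y => M y - N y) x = pdM μ M x - pdM μ N x := by
  ext i j
  exact pd_sub hU (hM i j) (hN i j) hx μ

lemma pdM_neg (μ : Fin n) : pdM μ (fun y => - M y) x = - pdM μ M x := by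
  ext i j
  exact pd_neg μ

lemma pdM_mul (hU : IsOpen U) (hM : SmM U M) (hN : SmM U N) (hx : x ∈ U) (μ : Fin n) :
    pdM μ (fun y => M y * N y) x = pdM μ M x * N x + M x * pdM μ N x := by
  ext i j
  simp only [pdM, Matrix.of_apply, Matrix.mul_apply, Matrix.add_apply]
  rw [pd_sum (U := U) _ hU (fun k => (hM i k).mul (hN k j)) hx, ← Finset.sum_add_distrib]
  exact Finset.sum_congr rfl fun k _ => pd_mul hU (hM i k) (hN k j) hx μ

lemma pdM_transpose (μ : Fin n) : pdM μ (fun y => (M y)ᵀ) x = (pdM μ M x)ᵀ := rfl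

lemma pdM_comm (hU : IsOpen U) (hM : SmM U M) (hx : x ∈ U) (μ ν : Fin n) :
    pdM μ (pdM ν M) x = pdM ν (pdM μ M) x := by
  ext i j
  exact pd_comm hU (hM i j) hx μ ν

lemma pdM_const (C : Matrix (Fin n) (Fin n) ℝ) (μ : Fin n) : pdM μ (fun _ => C) x = 0 := by
  ext i j
  simp [pdM, pd]

end mat

/-! ### Geometry -/

/-- Connection matrix `(Γ_k)^a_j`. -/
noncomputable def Gam {n : ℕ} (g : (Fin n → ℝ) → Matrix (Fin n) (Fin n) ℝ) (k : Fin n)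
    (x : Fin n → ℝ) : Matrix (Fin n) (Fin n) ℝ := Matrix.of fun a j => levi g x a j k

/-- Curvature matrix `(F_{ki})^a_j`. -/
noncomputable def Cur {n : ℕ} (g : (Fin n → ℝ) → Matrix (Fin n) (Fin n) ℝ) (k i : Fin n)
    (x : Fin n → ℝ) : Matrix (Fin n) (Fin n) ℝ :=
  pdM k (Gam g i) x - pdM i (Gam g k) x + (Gam g k x * Gam g i x - Gam g i x * Gam g k x)

/-- Twice the connection with the first index lowered. -/
noncomputable def Kos {n : ℕ} (g : (Fin n → ℝ) → Matrix (Fin n) (Fin n) ℝ) (b : Fin n)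
    (x : Fin n → ℝ) : Matrix (Fin n) (Fin n) ℝ := Matrix.of fun m a =>
  (1 / 2) * (pd b (fun y => g y a m) x + pd a (fun y => g y m b) x - pd m (fun y => g y a b) x)

section geo
variable {n : ℕ} {U : Set (Fin n → ℝ)} {g : (Fin n → ℝ) → Matrix (Fin n) (Fin n) ℝ}
  {x : Fin n → ℝ}

lemma riem_eq (a j k i : Fin n) : riem g x a j k i = Cur g k i x a j := by
  simp [riem, Cur, Gam, pdM, Matrix.mul_apply, Finset.sum_sub_distrib]

lemma Gam_eq (k : Fin n) : Gam g k x = (g x)⁻¹ * Kos g k x := by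
  ext a j
  simp only [Gam, Kos, levi, Matrix.mul_apply, Matrix.of_apply, Finset.mul_sum]
  exact Finset.sum_congr rfl fun m _ => by ring

lemma Gam_smooth (hU : IsOpen U) (hg : SmM U g) (hd : ∀ y ∈ U, IsUnit (g y).det) (k : Fin n) :
    SmM U (Gam g k) := by
  have h : SmM U (Kos g k) := fun i j =>
    contDiffOn_const.mul (((pd_smooth hU (hg _ _) _).add (pd_smooth hU (hg _ _) _)).sub
      (pd_smooth hU (hg _ _) _))
  have h2 := (hg.inv hd).mul h
  have h3 : Gam g k = fun y => (g y)⁻¹ * Kos g k y := funext fun y => Gam_eq k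
  rw [h3]; exact h2

lemma Cur_smooth (hU : IsOpen U) (hG : ∀ k, SmM U (Gam g k)) (k i : Fin n) :
    SmM U (Cur g k i) :=
  (((hG i).pd hU k).sub ((hG k).pd hU i)).add (((hG k).mul (hG i)).sub ((hG i).mul (hG k)))

lemma sym_entry (hs : ∀ y ∈ U, (g y)ᵀ = g y) {y : Fin n → ℝ} (hy : y ∈ U) (a b : Fin n) :
    g y a b = g y b a := by
  conv_lhs => rw [← hs y hy]
  rfl

lemma pd_sym (hU : IsOpen U) (hs : ∀ y ∈ U, (g y)ᵀ = g y) (hx : x ∈ U) (μ a b : Fin n) :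
    pd μ (fun y => g y a b) x = pd μ (fun y => g y b a) x :=
  pd_congr hU hx (fun _ hy => sym_entry hs hy a b) μ

lemma levi_symm (hU : IsOpen U) (hs : ∀ y ∈ U, (g y)ᵀ = g y) (hx : x ∈ U) (a b c : Fin n) :
    levi g x a b c = levi g x a c b := by
  unfold levi
  congr 1
  refine Finset.sum_congr rfl fun m _ => ?_
  rw [pd_sym hU hs hx c b m, pd_sym hU hs hx b m c, pd_sym hU hs hx m b c]
  ring

lemma inv_symm (hs : ∀ y ∈ U, (g y)ᵀ = g y) (hx : x ∈ U) : ((g x)⁻¹)ᵀ = (g x)⁻¹ := by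
  rw [Matrix.transpose_nonsing_inv, hs x hx]

/-- Metric compatibility for the inverse metric. -/
lemma compat (hU : IsOpen U) (hg : SmM U g) (hs : ∀ y ∈ U, (g y)ᵀ = g y)
    (hd : ∀ y ∈ U, IsUnit (g y).det) (hx : x ∈ U) (l : Fin n) :
    pdM l (fun y => (g y)⁻¹) x = -(Gam g l x * (g x)⁻¹ + (g x)⁻¹ * (Gam g l x)ᵀ) := by
  have h1 : pdM l g x = Kos g l x + (Kos g l x)ᵀ := by
    ext a b
    simp only [Kos, pdM, Matrix.add_apply, Matrix.transpose_apply, Matrix.of_apply]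
    rw [pd_sym hU hs hx l b a, pd_sym hU hs hx b a l, pd_sym hU hs hx a b l]
    ring
  have h2 : pdM l (fun y => (g y)⁻¹ * g y) x = 0 := by
    rw [pdM_congr (N := fun _ => 1) hU hx (fun y hy => Matrix.nonsing_inv_mul _ (hd y hy)),
      pdM_const]
  rw [pdM_mul hU (hg.inv hd) hg hx] at h2
  have h3 : (g x) * (g x)⁻¹ = 1 := Matrix.mul_nonsing_inv _ (hd x hx)
  have h4 : pdM l (fun y => (g y)⁻¹) x = -((g x)⁻¹ * pdM l g x * (g x)⁻¹) := by
    have := congrArg (· * (g x)⁻¹) h2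
    simp only [add_mul, mul_assoc, h3, mul_one, zero_mul] at this
    rw [mul_assoc]
    exact eq_neg_of_add_eq_zero_left this
  rw [h4, h1, Gam_eq, Matrix.transpose_mul, inv_symm hs hx]
  noncomm_ring

/-- Antisymmetry of the curvature with its first pair raised. -/
lemma Cur_anti (hU : IsOpen U) (hg : SmM U g) (hs : ∀ y ∈ U, (g y)ᵀ = g y)
    (hd : ∀ y ∈ U, IsUnit (g y).det) (hx : x ∈ U) (k i : Fin n) :
    (Cur g k i x * (g x)⁻¹)ᵀ = -(Cur g k i x * (g x)⁻¹) := by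
  have hG := Gam_smooth hU hg hd
  have hI := hg.inv hd
  have hc := pdM_comm hU hI hx k i
  have e : ∀ k i, pdM k (pdM i (fun y => (g y)⁻¹)) x =
      -(pdM k (Gam g i) x * (g x)⁻¹ + Gam g i x * pdM k (fun y => (g y)⁻¹) x
        + (pdM k (fun y => (g y)⁻¹) x * (Gam g i x)ᵀ + (g x)⁻¹ * (pdM k (Gam g i) x)ᵀ)) := by
    intro k i
    rw [pdM_congr hU hx (fun y hy => compat hU hg hs hd hy i), pdM_neg,
      pdM_add hU ((hG i).mul hI) (hI.mul (hG i).transpose) hx, pdM_mul hU (hG i) hI hx,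
      pdM_mul hU hI (hG i).transpose hx, pdM_transpose]
  rw [e, e, compat hU hg hs hd hx, compat hU hg hs hd hx] at hc
  rw [Matrix.transpose_mul, inv_symm hs hx]
  unfold Cur
  simp only [Matrix.transpose_add, Matrix.transpose_sub, Matrix.transpose_mul]
  rw [← sub_eq_zero] at hc ⊢
  rw [← neg_eq_zero, ← hc]
  noncomm_ring

lemma Cur_swap (k i : Fin n) : Cur g k i x = - Cur g i k x := by
  unfold Cur; abel

/-- Second Bianchi identity, first pair of indices raised. -/
lemma bianchi (hU : IsOpen U) (hg : SmM U g) (hs : ∀ y ∈ U, (g y)ᵀ = g y)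
    (hd : ∀ y ∈ U, IsUnit (g y).det) (hx : x ∈ U) (S : Fin n → Fin n → (Fin n → ℝ) →
      Matrix (Fin n) (Fin n) ℝ) (hS : S = fun k i y => Cur g k i y * (g y)⁻¹) (l k i : Fin n) :
    (pdM l (S k i) x + Gam g l x * S k i x + S k i x * (Gam g l x)ᵀ)
    + (pdM k (S i l) x + Gam g k x * S i l x + S i l x * (Gam g k x)ᵀ)
    + (pdM i (S l k) x + Gam g i x * S l k x + S l k x * (Gam g i x)ᵀ) = 0 := by
  have hG := Gam_smooth hU hg hd
  have hI := hg.inv hd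
  have e : ∀ l k i, pdM l (S k i) x + Gam g l x * S k i x + S k i x * (Gam g l x)ᵀ =
      (pdM l (Cur g k i) x + Gam g l x * Cur g k i x - Cur g k i x * Gam g l x) * (g x)⁻¹ := by
    intro l k i
    subst hS
    simp only
    rw [pdM_mul hU (Cur_smooth hU hG k i) hI hx, compat hU hg hs hd hx]
    noncomm_ring
  have e2 : ∀ l k i, pdM l (Cur g k i) x = pdM l (pdM k (Gam g i)) x - pdM l (pdM i (Gam g k)) x
      + (pdM l (Gam g k) x * Gam g i x + Gam g k x * pdM l (Gam g i) x
        - (pdM l (Gam g i) x * Gam g k x + Gam g i x * pdM l (Gam g k) x)) := by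
    intro l k i
    unfold Cur
    rw [pdM_add hU (((hG i).pd hU k).sub ((hG k).pd hU i))
        (((hG k).mul (hG i)).sub ((hG i).mul (hG k))) hx,
      pdM_sub hU ((hG i).pd hU k) ((hG k).pd hU i) hx,
      pdM_sub hU ((hG k).mul (hG i)) ((hG i).mul (hG k)) hx,
      pdM_mul hU (hG k) (hG i) hx, pdM_mul hU (hG i) (hG k) hx]
  rw [e, e, e, ← add_mul, ← add_mul, e2, e2, e2, pdM_comm hU (hG i) hx l k,
    pdM_comm hU (hG k) hx i l, pdM_comm hU (hG l) hx k i]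
  unfold Cur
  convert zero_mul _
  noncomm_ring

/-- Contracted Bianchi identity in mixed form, as a statement about index arrays. -/
lemma contracted (hU : IsOpen U) (hg : SmM U g) (hs : ∀ y ∈ U, (g y)ᵀ = g y)
    (hd : ∀ y ∈ U, IsUnit (g y).det) (hx : x ∈ U) (l : Fin n) :
    pd l (scal g) x = 2 * ((∑ a, pdM a (fun y => (g y)⁻¹ * Matrix.of (ricci g y)) x a l)
      + (∑ a, ∑ m, levi g x a m a * ((g x)⁻¹ * Matrix.of (ricci g x)) m l)
      - ∑ a, ∑ m, levi g x a m l * ((g x)⁻¹ * Matrix.of (ricci g x)) m a) := by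
  obtain ⟨S, hS⟩ : ∃ S : Fin n → Fin n → (Fin n → ℝ) → Matrix (Fin n) (Fin n) ℝ,
    S = fun k i y => Cur g k i y * (g y)⁻¹ := ⟨_, rfl⟩
  obtain ⟨P, hP⟩ : ∃ P : (Fin n → ℝ) → Matrix (Fin n) (Fin n) ℝ,
    P = fun y => (g y)⁻¹ * Matrix.of (ricci g y) := ⟨_, rfl⟩
  have hG := Gam_smooth hU hg hd
  have hI := hg.inv hd
  have hSs : ∀ k i, SmM U (S k i) := by
    subst hS; exact fun k i => (Cur_smooth hU hG k i).mul hI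
  have anti : ∀ y ∈ U, ∀ k i a b, S k i y a b = - S k i y b a := by
    intro y hy k i a b
    have := congrFun (congrFun (Cur_anti hU hg hs hd hy k i) b) a
    subst hS
    simpa using this
  have swap : ∀ y k i a b, S k i y a b = - S i k y a b := by
    intro y k i a b
    subst hS
    simp only [Cur_swap k i, neg_mul, Matrix.neg_apply]
  have hPS : ∀ y ∈ U, ∀ j i, P y j i = ∑ a, S a i y a j := by
    intro y hy j i
    subst hP hS
    simp only [Matrix.mul_apply, Matrix.of_apply, ricci, riem_eq, Finset.mul_sum]
    rw [Finset.sum_comm]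
    refine Finset.sum_congr rfl fun a _ => Finset.sum_congr rfl fun m _ => ?_
    have := congrFun (congrFun (inv_symm hs hy) m) j
    rw [Matrix.transpose_apply] at this
    rw [this]; ring
  have hR : ∀ y ∈ U, scal g y = ∑ b, ∑ a, S a b y a b := by
    intro y hy
    have h1 : scal g y = ∑ b, P y b b := by
      subst hP
      simp only [Matrix.mul_apply, Matrix.of_apply, scal]
      rw [Finset.sum_comm]
      refine Finset.sum_congr rfl fun a _ => Finset.sum_congr rfl fun m _ => ?_
      have := congrFun (congrFun (inv_symm hs hy) m) a
      rw [Matrix.transpose_apply] at this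
      rw [this]
    rw [h1]
    exact Finset.sum_congr rfl fun b _ => hPS y hy b b
  have hB : ∀ a b, _ := fun a b => congrFun (congrFun (bianchi hU hg hs hd hx S hS l a b) a) b
  change _ = 2 * ((∑ a, pdM a (fun y => (g y)⁻¹ * Matrix.of (ricci g y)) x a l)
      + (∑ a, ∑ m, levi g x a m a * ((fun y => (g y)⁻¹ * Matrix.of (ricci g y)) x) m l)
      - ∑ a, ∑ m, levi g x a m l * ((fun y => (g y)⁻¹ * Matrix.of (ricci g y)) x) m a)
  rw [← hP]
  -- derivative terms
  have d1 : pd l (scal g) x = ∑ a, ∑ b, pd l (fun y => S a b y a b) x := by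
    rw [pd_congr hU hx hR, pd_sum _ hU (fun b => ContDiffOn.sum fun a _ => hSs a b a b) hx,
      Finset.sum_comm]
    exact Finset.sum_congr rfl fun b _ => pd_sum _ hU (fun a => hSs a b a b) hx l
  have d0 : ∀ c j, pd c (fun y => P y j l) x = ∑ a, pd c (fun y => S a l y a j) x := by
    intro c j
    rw [pd_congr hU hx (fun y hy => hPS y hy j l), pd_sum _ hU (fun a => hSs a l a j) hx]
  have d2 : ∑ a, ∑ b, pd a (fun y => S b l y a b) x = - ∑ a, pdM a P x a l := by
    rw [← Finset.sum_neg_distrib]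
    refine Finset.sum_congr rfl fun a _ => ?_
    simp only [pdM, Matrix.of_apply]
    rw [d0, ← Finset.sum_neg_distrib]
    refine Finset.sum_congr rfl fun b _ => ?_
    rw [pd_congr hU hx (fun y hy => anti y hy b l a b), pd_neg]
  have d3 : ∑ a, ∑ b, pd b (fun y => S l a y a b) x = - ∑ a, pdM a P x a l := by
    rw [Finset.sum_comm, ← Finset.sum_neg_distrib]
    refine Finset.sum_congr rfl fun a _ => ?_
    simp only [pdM, Matrix.of_apply]
    rw [d0, ← Finset.sum_neg_distrib]
    refine Finset.sum_congr rfl fun b _ => ?_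
    rw [pd_congr hU hx (fun y _ => swap y l b b a), pd_neg]
  -- connection terms
  have x1 : ∑ a, ∑ b, ∑ m, levi g x a m l * S a b x m b = ∑ a, ∑ m, levi g x a m l * P x m a := by
    refine Finset.sum_congr rfl fun a _ => ?_
    rw [Finset.sum_comm]
    refine Finset.sum_congr rfl fun m _ => ?_
    rw [hPS x hx, Finset.mul_sum]
    refine Finset.sum_congr rfl fun b _ => ?_
    rw [swap x a b, anti x hx b a, neg_neg]
  have x2 : ∑ a, ∑ b, ∑ m, S a b x a m * levi g x b m l = ∑ a, ∑ m, levi g x a m l * P x m a := by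
    rw [Finset.sum_comm]
    refine Finset.sum_congr rfl fun a _ => ?_
    rw [Finset.sum_comm]
    refine Finset.sum_congr rfl fun m _ => ?_
    rw [hPS x hx, Finset.mul_sum]
    exact Finset.sum_congr rfl fun b _ => mul_comm _ _
  have x3 : ∑ a, ∑ b, ∑ m, levi g x a m a * S b l x m b
      = - ∑ a, ∑ m, levi g x a m a * P x m l := by
    rw [← Finset.sum_neg_distrib]
    refine Finset.sum_congr rfl fun a _ => ?_
    rw [Finset.sum_comm, ← Finset.sum_neg_distrib]
    refine Finset.sum_congr rfl fun m _ => ?_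
    rw [hPS x hx, Finset.mul_sum, ← Finset.sum_neg_distrib]
    refine Finset.sum_congr rfl fun b _ => ?_
    rw [anti x hx b l]; ring
  have x4 : ∑ a, ∑ b, ∑ m, S l a x a m * levi g x b m b
      = - ∑ a, ∑ m, levi g x a m a * P x m l := by
    rw [Finset.sum_comm, ← Finset.sum_neg_distrib]
    refine Finset.sum_congr rfl fun a _ => ?_
    rw [Finset.sum_comm, ← Finset.sum_neg_distrib]
    refine Finset.sum_congr rfl fun m _ => ?_
    rw [hPS x hx, Finset.mul_sum, ← Finset.sum_neg_distrib]
    refine Finset.sum_congr rfl fun b _ => ?_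
    rw [swap x l b]; ring
  have x5 : ∑ a, ∑ b, ∑ m, S b l x a m * levi g x b m a = 0 := by
    rw [Finset.sum_comm]
    refine Finset.sum_eq_zero fun b _ => ?_
    have : ∑ a, ∑ m, S b l x a m * levi g x b m a = - ∑ a, ∑ m, S b l x a m * levi g x b m a := by
      conv_lhs => rw [Finset.sum_comm]
      simp only [← Finset.sum_neg_distrib]
      refine Finset.sum_congr rfl fun a _ => Finset.sum_congr rfl fun m _ => ?_
      rw [anti x hx b l m a, levi_symm hU hs hx b a m]; ring
    linarith
  have x6 : ∑ a, ∑ b, ∑ m, levi g x a m b * S l a x m b = 0 := by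
    refine Finset.sum_eq_zero fun a _ => ?_
    have : ∑ b, ∑ m, levi g x a m b * S l a x m b = - ∑ b, ∑ m, levi g x a m b * S l a x m b := by
      conv_lhs => rw [Finset.sum_comm]
      simp only [← Finset.sum_neg_distrib]
      refine Finset.sum_congr rfl fun b _ => Finset.sum_congr rfl fun m _ => ?_
      rw [anti x hx l a b m, levi_symm hU hs hx a b m]; ring
    linarith
  have hsum := Finset.sum_congr (rfl : (Finset.univ : Finset (Fin n)) = Finset.univ)
    fun a _ => Finset.sum_congr (rfl : (Finset.univ : Finset (Fin n)) = Finset.univ)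
      fun b _ => (hB a b).trans (show _ = (0 : ℝ) from rfl)
  simp only [Matrix.add_apply, Matrix.mul_apply, Matrix.transpose_apply, Matrix.zero_apply,
    Finset.sum_add_distrib, Finset.sum_const_zero, Gam, Matrix.of_apply] at hsum
  rw [x1, x2, x3, x4, x5, x6] at hsum
  simp only [pdM, Matrix.of_apply] at hsum d2 d3 ⊢
  rw [← d1, d2, d3] at hsum
  linarith

end geo

/-- fully contracted Jacobi–Bianchi identity: the covariant divergence of
the Einstein curvature tensor vanishes,
`∂_μ E^{μκ} + E^{ρκ} Λ^μ_{ρμ} + E^{μρ} Λ^κ_{ρμ} = 0`. -/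
theorem einstein_tensor_divergence_free
    (n : ℕ) (U : Set (Fin n → ℝ)) (hU : IsOpen U)
    (g : (Fin n → ℝ) → Matrix (Fin n) (Fin n) ℝ)
    (hg : ∀ μ ν : Fin n, ContDiffOn ℝ (⊤ : ℕ∞) (fun x => g x μ ν) U)
    (hgsym : ∀ x ∈ U, (g x)ᵀ = g x)
    (hginv : ∀ x ∈ U, IsUnit (g x).det) :
    ∀ x ∈ U, ∀ κ : Fin n,
      (∑ μ, pd μ (fun y => einsteinUp g y μ κ) x)
        + (∑ μ, ∑ ρ, einsteinUp g x ρ κ * levi g x μ ρ μ)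
        + (∑ μ, ∑ ρ, einsteinUp g x μ ρ * levi g x κ ρ μ) = 0 := by
  intro x hx κ
  have hg' : SmM U g := hg
  have hG := Gam_smooth hU hg' hginv
  have hI := hg'.inv hginv
  have hRic : SmM U (fun y => Matrix.of (ricci g y)) := by
    intro i j
    simp only [Matrix.of_apply, ricci, riem_eq]
    exact ContDiffOn.sum fun a _ => Cur_smooth hU hG a j a i
  have hScal : ContDiffOn ℝ ∞ (scal g) U := by
    unfold scal
    exact ContDiffOn.sum fun j _ => ContDiffOn.sum fun i _ => (hI j i).mul (hRic j i)
  have hC : ∀ l, _ := fun l => contracted hU hg' hgsym hginv hx l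
  obtain ⟨P, hP⟩ : ∃ P : (Fin n → ℝ) → Matrix (Fin n) (Fin n) ℝ,
    P = fun y => (g y)⁻¹ * Matrix.of (ricci g y) := ⟨_, rfl⟩
  have hPs : SmM U P := by subst hP; exact hI.mul hRic
  have hPx : (g x)⁻¹ * Matrix.of (ricci g x) = P x := by rw [hP]
  rw [← hP, hPx] at hC
  obtain ⟨Q, hQ⟩ : ∃ Q : (Fin n → ℝ) → Matrix (Fin n) (Fin n) ℝ,
    Q = fun y => Matrix.of fun i j => (1 / 2 * (1 : Matrix (Fin n) (Fin n) ℝ) i j) * scal g y :=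
    ⟨_, rfl⟩
  have hQs : SmM U Q := by subst hQ; exact fun i j => contDiffOn_const.mul hScal
  have hE : ∀ y ∈ U, Matrix.of (einsteinUp g y) = (P y - Q y) * (g y)⁻¹ := by
    intro y hy
    have hQ' : Q y = (1 / 2 * scal g y) • (1 : Matrix (Fin n) (Fin n) ℝ) := by
      subst hQ; ext i j; simp; ring
    have h1 : Matrix.of (einsteinUp g y)
        = (g y)⁻¹ * (Matrix.of (ricci g y) - (1 / 2 * scal g y) • g y) * ((g y)⁻¹)ᵀ := by
      ext i j
      simp only [einsteinUp, Matrix.mul_apply, Matrix.of_apply, Matrix.transpose_apply,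
        Matrix.sub_apply, Matrix.smul_apply, smul_eq_mul, Finset.sum_mul]
      rw [Finset.sum_comm]
      exact Finset.sum_congr rfl fun a _ => Finset.sum_congr rfl fun b _ => by ring
    rw [h1, inv_symm hgsym hy, hQ', hP, mul_sub, Matrix.mul_smul,
      Matrix.nonsing_inv_mul _ (hginv y hy)]
  have hdE : ∀ μ, pdM μ (fun y => Matrix.of (einsteinUp g y)) x
      + Gam g μ x * Matrix.of (einsteinUp g x) + Matrix.of (einsteinUp g x) * (Gam g μ x)ᵀ
      = (pdM μ P x - pdM μ Q x + Gam g μ x * P x - P x * Gam g μ x) * (g x)⁻¹ := by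
    intro μ
    have hQ' : Q x = (1 / 2 * scal g x) • (1 : Matrix (Fin n) (Fin n) ℝ) := by
      subst hQ; ext i j; simp; ring
    have hcm : Gam g μ x * Q x = Q x * Gam g μ x := by
      rw [hQ', Matrix.mul_smul, Matrix.smul_mul, mul_one, one_mul]
    rw [pdM_congr hU hx hE, pdM_mul hU (hPs.sub hQs) hI hx, pdM_sub hU hPs hQs hx,
      compat hU hg' hgsym hginv hx, hE x hx]
    have : Gam g μ x * ((P x - Q x) * (g x)⁻¹)
        = (Gam g μ x * P x - Q x * Gam g μ x) * (g x)⁻¹ := by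
      rw [← hcm]; noncomm_ring
    rw [this]
    noncomm_ring
  have hdQ : ∀ μ b, pdM μ Q x μ b = (1 / 2 * (1 : Matrix (Fin n) (Fin n) ℝ) μ b) * pd μ (scal g) x := by
    intro μ b
    subst hQ
    simp only [pdM, Matrix.of_apply]
    rw [pd_mul hU contDiffOn_const hScal hx]
    simp [pd]
  have hz : ∀ b, ∑ μ, (pdM μ P x - pdM μ Q x + Gam g μ x * P x - P x * Gam g μ x) μ b = 0 := by
    intro b
    simp only [Matrix.sub_apply, Matrix.add_apply, Finset.sum_sub_distrib, Finset.sum_add_distrib,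
      hdQ, Matrix.mul_apply, Gam, Matrix.of_apply]
    have e1 : ∑ μ, (1 / 2 * (1 : Matrix (Fin n) (Fin n) ℝ) μ b) * pd μ (scal g) x
        = 1 / 2 * pd b (scal g) x := by
      rw [Finset.sum_eq_single b]
      · simp
      · intro c _ hc; simp [hc]
      · simp
    have e2 : ∑ μ, ∑ m, P x μ m * levi g x m b μ = ∑ a, ∑ m, levi g x a m b * P x m a := by
      rw [Finset.sum_comm]
      refine Finset.sum_congr rfl fun a _ => Finset.sum_congr rfl fun m _ => ?_
      rw [levi_symm hU hgsym hx a b m, mul_comm]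
    rw [e1, e2, hC b]
    ring
  have hfin : ∑ μ, ((pdM μ P x - pdM μ Q x + Gam g μ x * P x - P x * Gam g μ x) * (g x)⁻¹) μ κ
      = 0 := by
    simp only [Matrix.mul_apply (N := (g x)⁻¹)]
    rw [Finset.sum_comm]
    refine Finset.sum_eq_zero fun b _ => ?_
    rw [← Finset.sum_mul, hz b, zero_mul]
  simp only [← hdE] at hfin
  simp only [Matrix.add_apply, Finset.sum_add_distrib, Matrix.mul_apply, Matrix.transpose_apply,
    pdM, Matrix.of_apply, Gam] at hfin
  rw [← hfin]
  congr 2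
  exact Finset.sum_congr rfl fun a _ => Finset.sum_congr rfl fun b _ => mul_comm _ _
end
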